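/- arXiv:2012.02963 — 3 statements merged into one kernel-verified Lean document; each statement's English description precedes it below -/
import Mathlib

section
/- The interval [0, 1.1] is forward invariant for the ODE dy/dt = f(y) with f(y) = 1.1 − y·(1 + 6.2·(1 − y)²): if y : [0, ∞) → ℝ is differentiable, satisfies y'(t) = f(y(t)) for all t ≥ 0, and y(0) ∈ [0, 1.1], then y(t) ∈ [0, 1.1] for all t ≥ 0. -/
noncomputable def f (y : ℝ) : ℝ := 1.1 - y * (1 + 6.2 * (1 - y) ^ 2)

/-- A solution of `y' = g(y)` starting below a level `c` with `g c < 0` stays below `c`. -/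
theorem le_of_hasDerivAt_of_neg {g y : ℝ → ℝ} {c : ℝ} (hc : g c < 0)
    (hy : ∀ t : ℝ, 0 ≤ t → HasDerivAt y (g (y t)) t) (h0 : y 0 ≤ c) {t : ℝ} (ht : 0 ≤ t) :
    y t ≤ c :=
  image_le_of_deriv_right_lt_deriv_boundary (B := fun _ => c) (B' := fun _ => 0)
    (fun s hs => (hy s hs.1).continuousAt.continuousWithinAt)
    (fun s hs => (hy s hs.1).hasDerivWithinAt) h0 (fun s => hasDerivAt_const s c)
    (fun s _ hs => by rw [hs]; exact hc) (Set.right_mem_Icc.2 ht)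

/-- A solution of `y' = g(y)` starting above a level `c` with `0 < g c` stays above `c`. -/
theorem ge_of_hasDerivAt_of_pos {g y : ℝ → ℝ} {c : ℝ} (hc : 0 < g c)
    (hy : ∀ t : ℝ, 0 ≤ t → HasDerivAt y (g (y t)) t) (h0 : c ≤ y 0) {t : ℝ} (ht : 0 ≤ t) :
    c ≤ y t := by
  have h := le_of_hasDerivAt_of_neg (g := fun x => -g (-x)) (y := fun s => -y s) (c := -c)
    (by simpa using hc) (fun s hs => by simpa using (hy s hs).fun_neg) (neg_le_neg h0) ht
  exact neg_le_neg_iff.1 h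

/-- The interval `[0, 1.1]` is forward invariant for `dy/dt = f(y)`. -/
theorem stmt_3 (y : ℝ → ℝ)
    (hderiv : ∀ t : ℝ, 0 ≤ t → HasDerivAt y (f (y t)) t)
    (h0 : y 0 ∈ Set.Icc (0 : ℝ) 1.1) :
    ∀ t : ℝ, 0 ≤ t → y t ∈ Set.Icc (0 : ℝ) 1.1 := fun _ ht =>
  ⟨ge_of_hasDerivAt_of_pos (by norm_num [f]) hderiv h0.1 ht,
    le_of_hasDerivAt_of_neg (by norm_num [f]) hderiv h0.2 ht⟩
end

section
/- Basin of attraction of the upper stable equilibrium: let y₂ ∈ (0.69, 0.70) and y₃ ∈ (1.06, 1.07) be the roots of f(y) = 1.1 − y·(1 + 6.2·(1 − y)²) in those intervals. If y : [0, ∞) → ℝ is differentiable, satisfies y'(t) = f(y(t)) for all t ≥ 0, and y(0) > y₂, then y(t) → y₃ as t → ∞. -/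
/-- Two distinct roots of `f` determine the third one, since the three roots add up to `2`. -/
lemma f_eq_mul_of_roots {a b : ℝ} (hab : a ≠ b) (ha : f a = 0) (hb : f b = 0) (x : ℝ) :
    f x = -6.2 * (x - (2 - a - b)) * (x - a) * (x - b) := by
  unfold f at *
  have hquot : -7.2 + 12.4 * (a + b) - 6.2 * (a ^ 2 + a * b + b ^ 2) = 0 := by
    apply mul_left_cancel₀ (sub_ne_zero.2 hab)
    linear_combination ha - hb
  linear_combination ha + (x - a) * hquot

/-- A solution of an autonomous equation cannot cross downwards a level at which the right-hand
side is positive. -/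
lemma le_of_hasDerivAt_of_pos {F y : ℝ → ℝ} {c : ℝ}
    (hderiv : ∀ t, 0 ≤ t → HasDerivAt y (F (y t)) t) (hF : 0 < F c) (h0 : c ≤ y 0)
    {t : ℝ} (ht : 0 ≤ t) : c ≤ y t := by
  have hle : -y t ≤ -c :=
    image_le_of_deriv_right_lt_deriv_boundary (f := fun s => -y s) (f' := fun s => -F (y s))
      (B := fun _ => -c) (B' := fun _ => 0)
      (fun s hs => (hderiv s hs.1).neg.continuousAt.continuousWithinAt)
      (fun s hs => (hderiv s hs.1).neg.hasDerivWithinAt)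
      (neg_le_neg h0) (fun s => hasDerivAt_const s (-c))
      (fun s _ hs => by rw [neg_inj.1 hs]; exact neg_neg_of_pos hF)
      (Set.right_mem_Icc.2 ht)
  exact neg_le_neg_iff.1 hle

/-- A nonnegative function with `V' ≤ -k V` for some `k > 0` tends to `0`. -/
lemma tendsto_zero_of_deriv_le_neg_mul {V V' : ℝ → ℝ} {k : ℝ} (hk : 0 < k)
    (hV : ∀ t, 0 ≤ t → HasDerivAt V (V' t) t) (hV' : ∀ t, 0 ≤ t → V' t ≤ -k * V t)
    (hnonneg : ∀ t, 0 ≤ V t) : Filter.Tendsto V Filter.atTop (nhds 0) := by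
  have hexp (t : ℝ) : HasDerivAt (fun s => Real.exp (k * s)) (Real.exp (k * t) * k) t := by
    simpa using ((hasDerivAt_id t).const_mul k).exp
  have hanti : AntitoneOn (fun t => V t * Real.exp (k * t)) (Set.Ici 0) := by
    refine antitoneOn_of_hasDerivWithinAt_nonpos (convex_Ici 0)
      (fun t ht => ((hV t ht).mul (hexp t)).continuousAt.continuousWithinAt)
      (fun t ht => ((hV t (interior_subset ht)).mul (hexp t)).hasDerivWithinAt) fun t ht => ?_
    nlinarith [mul_le_mul_of_nonneg_right (hV' t (interior_subset ht)) (Real.exp_pos (k * t)).le]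
  have hdecay : Filter.Tendsto (fun t => V 0 * Real.exp (-(k * t))) Filter.atTop (nhds 0) := by
    simpa using (Real.tendsto_exp_neg_atTop_nhds_zero.comp
      (Filter.tendsto_id.const_mul_atTop hk)).const_mul (V 0)
  refine squeeze_zero' (.of_forall hnonneg) ?_ hdecay
  filter_upwards [Filter.eventually_ge_atTop 0] with t ht
  have hle : V t * Real.exp (k * t) ≤ V 0 := by
    simpa using hanti Set.self_mem_Ici (Set.mem_Ici.2 ht) ht
  rwa [Real.exp_neg, ← div_eq_mul_inv, le_div_iff₀ (Real.exp_pos _)]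

/-- Basin of attraction of the upper stable equilibrium: a solution starting
above the unstable root `y₂` converges to the stable root `y₃`. -/
theorem stmt_5 (y₂ y₃ : ℝ)
    (hy₂ : y₂ ∈ Set.Ioo (0.69 : ℝ) 0.70) (hroot₂ : f y₂ = 0)
    (hy₃ : y₃ ∈ Set.Ioo (1.06 : ℝ) 1.07) (hroot₃ : f y₃ = 0)
    (y : ℝ → ℝ)
    (hderiv : ∀ t : ℝ, 0 ≤ t → HasDerivAt y (f (y t)) t)
    (h0 : y 0 > y₂) :
    Filter.Tendsto y Filter.atTop (nhds y₃) := by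
  obtain ⟨h₂l, h₂u⟩ := hy₂
  obtain ⟨h₃l, h₃u⟩ := hy₃
  have hfac := f_eq_mul_of_roots (by linarith : y₂ ≠ y₃) hroot₂ hroot₃
  obtain ⟨c, hc₂, hc⟩ := exists_between (lt_min h0 (by linarith : y₂ < y₃))
  obtain ⟨hc0, hc₃⟩ := lt_min_iff.1 hc
  have hc₁ : 0 < c - (2 - y₂ - y₃) := by linarith
  have hfc : 0 < f c := by
    rw [hfac]
    nlinarith [mul_pos (mul_pos hc₁ (sub_pos.2 hc₂)) (sub_pos.2 hc₃)]
  have hsq : Filter.Tendsto (fun t => (y t - y₃) ^ 2) Filter.atTop (nhds 0) := by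
    refine tendsto_zero_of_deriv_le_neg_mul
      (k := 12.4 * ((c - (2 - y₂ - y₃)) * (c - y₂))) (V' := fun t => 2 * (y t - y₃) * f (y t))
      (mul_pos (by norm_num) (mul_pos hc₁ (sub_pos.2 hc₂)))
      (fun t ht => by simpa using ((hderiv t ht).sub_const y₃).fun_pow 2)
      (fun t ht => ?_) (fun t => sq_nonneg _)
    have hct := le_of_hasDerivAt_of_pos hderiv hfc hc0.le ht
    have hmul : (c - (2 - y₂ - y₃)) * (c - y₂) ≤ (y t - (2 - y₂ - y₃)) * (y t - y₂) :=
      mul_le_mul (by linarith) (by linarith) (by linarith) (by linarith)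
    rw [hfac]
    linarith [mul_le_mul_of_nonneg_right hmul (sq_nonneg (y t - y₃))]
  rw [tendsto_iff_dist_tendsto_zero]
  simpa [Real.sqrt_sq_eq_abs, Real.dist_eq] using hsq.sqrt
end

section
/- Basin of attraction of the lower stable equilibrium: let y₁ ∈ (0.240, 0.241) and y₂ ∈ (0.69, 0.70) be the roots of f(y) = 1.1 − y·(1 + 6.2·(1 − y)²) in those intervals. If y : [0, ∞) → ℝ is differentiable, satisfies y'(t) = f(y(t)) for all t ≥ 0, and y(0) < y₂, then y(t) → y₁ as t → ∞. -/
/-- Grönwall estimate for a scalar linear equation `q' = a q` with `a ≤ c`. -/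
theorem sq_le_sq_mul_exp_of_hasDerivAt {q a : ℝ → ℝ} {c T : ℝ} (hT : 0 ≤ T)
    (hq : ∀ t ∈ Set.Icc 0 T, HasDerivAt q (a t * q t) t) (ha : ∀ t ∈ Set.Icc 0 T, a t ≤ c) :
    q T ^ 2 ≤ q 0 ^ 2 * Real.exp (2 * c * T) := by
  have hd : ∀ t ∈ Set.Icc 0 T, HasDerivAt (fun t => q t ^ 2 * Real.exp (-(2 * c * t)))
      (2 * (a t - c) * (q t ^ 2 * Real.exp (-(2 * c * t)))) t := by
    intro t ht
    have he : HasDerivAt (fun t => Real.exp (-(2 * c * t)))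
        (Real.exp (-(2 * c * t)) * -(2 * c * 1)) t :=
      ((hasDerivAt_id t).const_mul (2 * c)).neg.exp
    refine (((hq t ht).fun_pow 2).fun_mul he).congr_deriv ?_
    push_cast
    ring
  have hanti : AntitoneOn (fun t => q t ^ 2 * Real.exp (-(2 * c * t))) (Set.Icc 0 T) := by
    refine antitoneOn_of_hasDerivWithinAt_nonpos (convex_Icc 0 T)
      (fun t ht => (hd t ht).continuousAt.continuousWithinAt)
      (fun t ht => (hd t (interior_subset ht)).hasDerivWithinAt) fun t ht => ?_
    exact mul_nonpos_of_nonpos_of_nonneg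
      (by linarith [ha t (interior_subset ht)]) (by positivity)
  have h := hanti (Set.left_mem_Icc.2 hT) (Set.right_mem_Icc.2 hT) hT
  simp only [mul_zero, neg_zero, Real.exp_zero, mul_one, Real.exp_neg] at h
  rwa [← div_eq_mul_inv, div_le_iff₀ (Real.exp_pos _)] at h

/-- A solution of `q' = a q` with positive initial value stays positive. -/
theorem pos_of_hasDerivAt_mul_self {q a : ℝ → ℝ} (ha : ContinuousOn a (Set.Ici 0))
    (hq : ∀ t, 0 ≤ t → HasDerivAt q (a t * q t) t) (h0 : 0 < q 0) {t : ℝ} (ht : 0 ≤ t) :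
    0 < q t := by
  by_contra! hneg
  have hcont : ContinuousOn q (Set.Icc 0 t) := fun s hs =>
    (hq s hs.1).continuousAt.continuousWithinAt
  obtain ⟨s, hs, hqs⟩ := intermediate_value_Icc' ht hcont ⟨hneg, h0.le⟩
  obtain ⟨K, hK⟩ := isCompact_Icc.exists_bound_of_continuousOn
    (ha.mono (Set.Icc_subset_Ici_self : Set.Icc 0 s ⊆ Set.Ici 0))
  have hrev : ∀ r ∈ Set.Icc 0 s,
      HasDerivAt (fun r => q (s - r)) (-a (s - r) * q (s - r)) r := by
    intro r hr
    exact ((hq (s - r) (by linarith [hr.2])).comp r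
      ((hasDerivAt_id r).const_sub s)).congr_deriv (by ring)
  have h := sq_le_sq_mul_exp_of_hasDerivAt (c := K) hs.1 hrev fun r hr =>
    (neg_le_abs _).trans (hK (s - r) ⟨by linarith [hr.2], by linarith [hr.1]⟩)
  simp only [sub_self, sub_zero, hqs] at h
  nlinarith [pow_pos h0 2]

/-- A solution of `q' = a q` with `a ≤ -c < 0` tends to zero. -/
theorem tendsto_zero_of_hasDerivAt_mul_self {q a : ℝ → ℝ} {c : ℝ} (hc : 0 < c)
    (hq : ∀ t, 0 ≤ t → HasDerivAt q (a t * q t) t) (ha : ∀ t, 0 ≤ t → a t ≤ -c) :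
    Filter.Tendsto q Filter.atTop (nhds 0) := by
  have hexp : Filter.Tendsto (fun t => q 0 ^ 2 * Real.exp (2 * -c * t))
      Filter.atTop (nhds 0) := by
    have hlin : Filter.Tendsto (fun t : ℝ => 2 * -c * t) Filter.atTop Filter.atBot :=
      Filter.tendsto_id.const_mul_atTop_of_neg (by linarith)
    simpa using (Real.tendsto_exp_atBot.comp hlin).const_mul (q 0 ^ 2)
  have hsq : Filter.Tendsto (fun t => q t ^ 2) Filter.atTop (nhds 0) := by
    refine squeeze_zero' (.of_forall fun t => sq_nonneg _) ?_ hexp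
    filter_upwards [Filter.eventually_ge_atTop 0] with t ht
    exact sq_le_sq_mul_exp_of_hasDerivAt ht (fun s hs => hq s hs.1) fun s hs => ha s hs.1
  rw [tendsto_zero_iff_abs_tendsto_zero]
  simpa [Function.comp_def, Real.sqrt_sq_eq_abs] using hsq.sqrt

/-- Two distinct roots of `f` determine the third, since the three roots sum to `2`. -/
theorem f_eq_mul_of_roots_s6 {y₁ y₂ : ℝ} (hne : y₁ ≠ y₂) (h₁ : f y₁ = 0) (h₂ : f y₂ = 0) (x : ℝ) :
    f x = 6.2 * (x - y₁) * (y₂ - x) * (x - (2 - y₁ - y₂)) := by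
  unfold f at *
  apply mul_left_cancel₀ (sub_ne_zero.2 hne)
  linear_combination (x - y₂) * h₁ - (x - y₁) * h₂

/-- Basin of attraction of the lower stable equilibrium: a solution starting
below the unstable root `y₂` converges to the stable root `y₁`. -/
theorem stmt_6 (y₁ y₂ : ℝ)
    (hy₁ : y₁ ∈ Set.Ioo (0.240 : ℝ) 0.241) (hroot₁ : f y₁ = 0)
    (hy₂ : y₂ ∈ Set.Ioo (0.69 : ℝ) 0.70) (hroot₂ : f y₂ = 0)
    (y : ℝ → ℝ)
    (hderiv : ∀ t : ℝ, 0 ≤ t → HasDerivAt y (f (y t)) t)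
    (h0 : y 0 < y₂) :
    Filter.Tendsto y Filter.atTop (nhds y₁) := by
  obtain ⟨hy₁l, hy₁u⟩ := hy₁
  obtain ⟨hy₂l, hy₂u⟩ := hy₂
  have hlt : y₁ < y₂ := by linarith
  have hfac := f_eq_mul_of_roots_s6 hlt.ne hroot₁ hroot₂
  set y₃ := 2 - y₁ - y₂ with hy₃
  have hlt' : y₂ < y₃ := by linarith
  have hcont : ContinuousOn y (Set.Ici 0) := fun t ht =>
    (hderiv t ht).continuousAt.continuousWithinAt
  have hpos : ∀ t, 0 ≤ t → 0 < y₂ - y t := fun t ht =>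
    pos_of_hasDerivAt_mul_self (q := fun t => y₂ - y t)
      (a := fun t => -6.2 * (y t - y₁) * (y t - y₃)) (by fun_prop)
      (fun s hs => by
        refine ((hderiv s hs).const_sub y₂).congr_deriv ?_
        rw [hfac]
        ring) (sub_pos.2 h0) ht
  have hq : Filter.Tendsto (fun t => (y t - y₁) / (y₂ - y t)) Filter.atTop (nhds 0) := by
    refine tendsto_zero_of_hasDerivAt_mul_self
      (a := fun t => -(6.2 * (y₂ - y₁) * (y₃ - y t))) (c := 6.2 * (y₂ - y₁) * (y₃ - y₂))
      (mul_pos (by linarith) (by linarith)) (fun t ht => ?_) fun t ht => ?_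
    · have hne := (hpos t ht).ne'
      refine (((hderiv t ht).sub_const y₁).fun_div
        ((hderiv t ht).const_sub y₂) hne).congr_deriv ?_
      rw [hfac]
      field_simp
      ring
    · exact neg_le_neg (mul_le_mul_of_nonneg_left (by linarith [hpos t ht]) (by linarith))
  have hlim := ((hq.mul_const y₂).const_add y₁).div (hq.const_add 1) (by norm_num)
  simp only [zero_mul, add_zero, div_one] at hlim
  refine hlim.congr' ?_
  filter_upwards [Filter.eventually_ge_atTop 0] with t ht
  have hne := (hpos t ht).ne'
  have hne' : y₂ - y₁ ≠ 0 := (sub_pos.2 hlt).ne'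
  have hden : 1 + (y t - y₁) / (y₂ - y t) = (y₂ - y₁) / (y₂ - y t) := by
    field_simp
    ring
  simp only [Pi.div_apply, hden]
  field_simp
  ring
end
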